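/- For p = 3: the matrices diag_{16,8}(J_α) (α = 1,…,8) and diag_{16,8}(C_1)·block_{8,16}(L_u) for u ∈ {i,j,k,e,f,g,h}, acting on R^{128}, form a set of 15 skew-symmetric matrices that square to −Id_{128} and pairwise anticommute, hence giving 15 orthonormal tangent vector fields on S^{127}, the maximal possible number. -/

import Mathlib

/-- The Cayley–Dickson algebra `A^n` obtained from `ℝ` by `n` doublings. -/
def CD : ℕ → Type
  | 0 => ℝ
  | n + 1 => CD n × CD n

namespace CD

def ofReal (r : ℝ) : CD 0 := r
def toReal (a : CD 0) : ℝ := a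

noncomputable def add : {n : ℕ} → CD n → CD n → CD n
  | 0, a, b => ofReal (toReal a + toReal b)
  | _ + 1, a, b => (add a.1 b.1, add a.2 b.2)

noncomputable def neg : {n : ℕ} → CD n → CD n
  | 0, a => ofReal (-toReal a)
  | _ + 1, a => (neg a.1, neg a.2)

noncomputable def sub {n : ℕ} (a b : CD n) : CD n := add a (neg b)

/-- Cayley–Dickson conjugation: `(a,b)* = (a*, -b)`. -/
noncomputable def conj : {n : ℕ} → CD n → CD n
  | 0, a => a
  | _ + 1, a => (conj a.1, neg a.2)

/-- Cayley–Dickson product: `(a,b)(c,d) = (ac - d*b, da + bc*)`. -/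
noncomputable def mul : {n : ℕ} → CD n → CD n → CD n
  | 0, a, b => ofReal (toReal a * toReal b)
  | _ + 1, a, b =>
      (sub (mul a.1 b.1) (mul (conj b.2) a.2), add (mul b.2 a.1) (mul a.2 (conj b.1)))

noncomputable def zero : (n : ℕ) → CD n
  | 0 => ofReal 0
  | n + 1 => (zero n, zero n)

/-- The real part `Re(a) = (a + a*)/2`, read off as a real number. -/
noncomputable def re : {n : ℕ} → CD n → ℝ
  | 0, a => toReal a
  | _ + 1, a => re a.1

/-- The standard Euclidean inner product under the identification `A^n = ℝ^(2^n)`. -/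
noncomputable def inner : {n : ℕ} → CD n → CD n → ℝ
  | 0, a, b => toReal a * toReal b
  | _ + 1, a, b => inner a.1 b.1 + inner a.2 b.2

end CD

/-- The octonions, as the third Cayley–Dickson algebra. -/
noncomputable abbrev Oct : Type := CD 3

noncomputable def r2 (a b : ℝ) : CD 1 := (CD.ofReal a, CD.ofReal b)
noncomputable def r4 (a b c d : ℝ) : CD 2 := (r2 a b, r2 c d)
noncomputable def r8 (a b c d e f g h : ℝ) : Oct := (r4 a b c d, r4 e f g h)

/-- The standard basis `1, i, j, k, e, f, g, h` of the octonions. -/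
noncomputable def octBasis : Fin 8 → Oct :=
  ![r8 1 0 0 0 0 0 0 0, r8 0 1 0 0 0 0 0 0, r8 0 0 1 0 0 0 0 0, r8 0 0 0 1 0 0 0 0,
    r8 0 0 0 0 1 0 0 0, r8 0 0 0 0 0 1 0 0, r8 0 0 0 0 0 0 1 0, r8 0 0 0 0 0 0 0 1]
open Matrix

/-- Reindexing a square matrix along an equality of dimensions. -/
noncomputable def castM {a b : ℕ} (h : a = b) (M : Matrix (Fin a) (Fin a) ℝ) :
    Matrix (Fin b) (Fin b) ℝ :=
  Matrix.reindex (finCongr h) (finCongr h) M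

/-- `diagExt m n A = Id_n ⊗ A`: the block-diagonal matrix with `n` copies of
the `m × m` matrix `A` along the diagonal. -/
noncomputable def diagExt (m n : ℕ) (A : Matrix (Fin m) (Fin m) ℝ) :
    Matrix (Fin (m * n)) (Fin (m * n)) ℝ :=
  Matrix.of fun i j =>
    if hm : 0 < m then
      if i.val / m = j.val / m then
        A ⟨i.val % m, Nat.mod_lt _ hm⟩ ⟨j.val % m, Nat.mod_lt _ hm⟩
      else 0
    else 0

/-- `blockExt m n A = A ⊗ Id_n`: each entry `a` of the `m × m` matrix `A` is
replaced by the `n × n` block `a • Id_n`. -/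
noncomputable def blockExt (m n : ℕ) (A : Matrix (Fin m) (Fin m) ℝ) :
    Matrix (Fin (m * n)) (Fin (m * n)) ℝ :=
  Matrix.of fun i j =>
    if hn : 0 < n then
      if i.val % n = j.val % n then
        A ⟨i.val / n, (Nat.div_lt_iff_lt_mul hn).2 i.isLt⟩
          ⟨j.val / n, (Nat.div_lt_iff_lt_mul hn).2 j.isLt⟩
      else 0
    else 0

/-- The matrix (in the standard orthonormal basis of `𝕆 = ℝ^8`) of right
multiplication `R_u : x ↦ x·u` by the octonion `u`. -/
noncomputable def Rmat (u : Oct) : Matrix (Fin 8) (Fin 8) ℝ :=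
  Matrix.of fun r c => CD.inner (CD.mul (octBasis c) u) (octBasis r)

/-- The matrix (in the standard orthonormal basis of `𝕆 = ℝ^8`) of left
multiplication `L_u : x ↦ u·x` by the octonion `u`. -/
noncomputable def Lmat (u : Oct) : Matrix (Fin 8) (Fin 8) ℝ :=
  Matrix.of fun r c => CD.inner (CD.mul u (octBasis c)) (octBasis r)

noncomputable def toMat16 (M : Matrix (Fin 8 ⊕ Fin 8) (Fin 8 ⊕ Fin 8) ℝ) :
    Matrix (Fin 16) (Fin 16) ℝ :=
  Matrix.reindex (finSumFinEquiv.trans (finCongr (show 8 + 8 = 16 by norm_num)))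
    (finSumFinEquiv.trans (finCongr (show 8 + 8 = 16 by norm_num))) M

/-- The eight standard `Spin(9)` complex structures on `ℝ^16` (indexed `0,…,7`
for `J₁,…,J₈`): `J₁ = [[0,-Id₈],[Id₈,0]]` and `J_{α+1} = [[0,R_u],[R_u,0]]` for
the imaginary octonion units `u = i,j,k,e,f,g,h`. -/
noncomputable def J16 (α : Fin 8) : Matrix (Fin 16) (Fin 16) ℝ :=
  toMat16 <|
    if α = 0 then Matrix.fromBlocks 0 (-1) 1 0
    else Matrix.fromBlocks 0 (Rmat (octBasis α)) (Rmat (octBasis α)) 0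

/-- The diagonal involution `C_N` changing sign on the last half of the
coordinates of `ℝ^N`. -/
noncomputable def Cmat (N : ℕ) : Matrix (Fin N) (Fin N) ℝ :=
  Matrix.diagonal fun i => if 2 * i.val < N then 1 else -1

/-- The diagonal extensions `diag_{16,8}(J_α)` on `ℝ^128`. -/
noncomputable def A128 (α : Fin 8) : Matrix (Fin 128) (Fin 128) ℝ :=
  castM (by norm_num) (diagExt 16 8 (J16 α))

/-- The twisted octonionic multiplications
`diag_{16,8}(C₁) · block_{8,16}(L_u)` on `ℝ^128`, for imaginary units `u`. -/
noncomputable def L128 (α : Fin 8) : Matrix (Fin 128) (Fin 128) ℝ :=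
  castM (by norm_num) (diagExt 16 8 (Cmat 16)) *
    castM (by norm_num) (blockExt 8 16 (Lmat (octBasis α)))

/-- The fifteen matrices of Statement 16: `diag_{16,8}(J_α)` for `α = 1,…,8`
and `diag_{16,8}(C₁) · block_{8,16}(L_u)` for `u ∈ {i,j,k,e,f,g,h}`. -/
noncomputable def G128 (β : Fin 15) : Matrix (Fin 128) (Fin 128) ℝ :=
  if h : β.val < 8 then A128 ⟨β.val, h⟩
  else L128 ⟨β.val - 7, by have := β.isLt; omega⟩

theorem Matrix.neg_two_eq_smul {n R : Type*} [DecidableEq n] [Fintype n] [CommRing R] :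
    (-2 : Matrix n n R) = (-2 : R) • (1 : Matrix n n R) := by
  simp [ofNat_smul_eq_nsmul]

theorem CD.mul_r8 (a b c d e f g h a' b' c' d' e' f' g' h' : ℝ) :
    CD.mul (r8 a b c d e f g h) (r8 a' b' c' d' e' f' g' h') =
      r8 (a * a' - b * b' - c * c' - d * d' - e * e' - f * f' - g * g' - h * h')
        (a * b' + b * a' + c * d' - d * c' + e * f' - f * e' - g * h' + h * g')
        (a * c' - b * d' + c * a' + d * b' + e * g' + f * h' - g * e' - h * f')
        (a * d' + b * c' - c * b' + d * a' + e * h' - f * g' + g * f' - h * e')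
        (a * e' - b * f' - c * g' - d * h' + e * a' + f * b' + g * c' + h * d')
        (a * f' + b * e' - c * h' + d * g' - e * b' + f * a' - g * d' + h * c')
        (a * g' + b * h' + c * e' - d * f' - e * c' + f * d' + g * a' - h * b')
        (a * h' - b * g' + c * f' + d * e' - e * d' - f * c' + g * b' + h * a') := by
  simp only [r8, r4, r2, CD.mul, CD.sub, CD.add, CD.neg, CD.conj, CD.toReal, CD.ofReal]
  refine Prod.ext (Prod.ext (Prod.ext ?_ ?_) (Prod.ext ?_ ?_))
    (Prod.ext (Prod.ext ?_ ?_) (Prod.ext ?_ ?_)) <;> (change @Eq ℝ _ _; dsimp only; ring)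

theorem CD.inner_r8 (a b c d e f g h a' b' c' d' e' f' g' h' : ℝ) :
    CD.inner (r8 a b c d e f g h) (r8 a' b' c' d' e' f' g' h') =
      a * a' + b * b' + c * c' + d * d' + e * e' + f * f' + g * g' + h * h' := by
  simp only [r8, r4, r2, CD.inner, CD.toReal, CD.ofReal]
  ring

theorem Lmat_imaginary (b c d e f g h : ℝ) :
    Lmat (r8 0 b c d e f g h) =
      !![0, -b, -c, -d, -e, -f, -g, -h;
         b, 0, -d, c, -f, e, h, -g;
         c, d, 0, -b, -g, -h, e, f;
         d, -c, b, 0, -h, g, -f, e;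
         e, f, g, h, 0, -b, -c, -d;
         f, -e, h, -g, b, 0, d, -c;
         g, -h, -e, f, c, -d, 0, b;
         h, g, -f, -e, d, c, -b, 0] := by
  ext r s
  fin_cases r <;> fin_cases s <;> simp [Lmat, octBasis, CD.mul_r8, CD.inner_r8]

theorem Rmat_imaginary (b c d e f g h : ℝ) :
    Rmat (r8 0 b c d e f g h) =
      !![0, -b, -c, -d, -e, -f, -g, -h;
         b, 0, d, -c, f, -e, -h, g;
         c, -d, 0, b, g, h, -e, -f;
         d, c, -b, 0, h, -g, f, -e;
         e, -f, -g, -h, 0, b, c, d;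
         f, e, -h, g, -b, 0, -d, c;
         g, h, e, -f, -c, d, 0, -b;
         h, -g, f, e, -d, -c, b, 0] := by
  ext r s
  fin_cases r <;> fin_cases s <;> simp [Rmat, octBasis, CD.mul_r8, CD.inner_r8]

theorem octBasis_imaginary {α : Fin 8} (hα : α ≠ 0) :
    ∃ b c d e f g h : ℝ, octBasis α = r8 0 b c d e f g h := by
  fin_cases α
  · exact absurd rfl hα
  all_goals exact ⟨_, _, _, _, _, _, _, rfl⟩

theorem CD.inner_octBasis (α β : Fin 8) :
    CD.inner (octBasis α) (octBasis β) = if α = β then 1 else 0 := by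
  fin_cases α <;> fin_cases β <;> simp [octBasis, CD.inner_r8]

theorem Lmat_transpose {α : Fin 8} (hα : α ≠ 0) :
    (Lmat (octBasis α))ᵀ = -Lmat (octBasis α) := by
  obtain ⟨b, c, d, e, f, g, h, hu⟩ := octBasis_imaginary hα
  rw [hu, Lmat_imaginary]
  ext r s
  fin_cases r <;> fin_cases s <;> simp

theorem Rmat_transpose {α : Fin 8} (hα : α ≠ 0) :
    (Rmat (octBasis α))ᵀ = -Rmat (octBasis α) := by
  obtain ⟨b, c, d, e, f, g, h, hu⟩ := octBasis_imaginary hα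
  rw [hu, Rmat_imaginary]
  ext r s
  fin_cases r <;> fin_cases s <;> simp

theorem Lmat_imaginary_mulVec (b c d e f g h x₀ x₁ x₂ x₃ x₄ x₅ x₆ x₇ : ℝ) :
    Lmat (r8 0 b c d e f g h) *ᵥ ![x₀, x₁, x₂, x₃, x₄, x₅, x₆, x₇] =
      ![-b * x₁ - c * x₂ - d * x₃ - e * x₄ - f * x₅ - g * x₆ - h * x₇,
        b * x₀ - d * x₂ + c * x₃ - f * x₄ + e * x₅ + h * x₆ - g * x₇,
        c * x₀ + d * x₁ - b * x₃ - g * x₄ - h * x₅ + e * x₆ + f * x₇,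
        d * x₀ - c * x₁ + b * x₂ - h * x₄ + g * x₅ - f * x₆ + e * x₇,
        e * x₀ + f * x₁ + g * x₂ + h * x₃ - b * x₅ - c * x₆ - d * x₇,
        f * x₀ - e * x₁ + h * x₂ - g * x₃ + b * x₄ + d * x₆ - c * x₇,
        g * x₀ - h * x₁ - e * x₂ + f * x₃ + c * x₄ - d * x₅ + b * x₇,
        h * x₀ + g * x₁ - f * x₂ - e * x₃ + d * x₄ + c * x₅ - b * x₆] := by
  rw [Lmat_imaginary]
  ext r
  fin_cases r <;> simp [Matrix.mulVec, dotProduct, Fin.sum_univ_eight] <;> ring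

theorem Lmat_clifford {α β : Fin 8} (hα : α ≠ 0) (hβ : β ≠ 0) :
    Lmat (octBasis α) * Lmat (octBasis β) + Lmat (octBasis β) * Lmat (octBasis α) =
      if α = β then -2 else 0 := by
  trans (-2 * CD.inner (octBasis α) (octBasis β)) • (1 : Matrix (Fin 8) (Fin 8) ℝ)
  · obtain ⟨b, c, d, e, f, g, h, hu⟩ := octBasis_imaginary hα
    obtain ⟨b', c', d', e', f', g', h', hv⟩ := octBasis_imaginary hβ
    refine Matrix.mulVec_injective (funext fun x => ?_)
    have hx : x = ![x 0, x 1, x 2, x 3, x 4, x 5, x 6, x 7] := by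
      ext r
      fin_cases r <;> rfl
    rw [hu, hv, CD.inner_r8, Matrix.add_mulVec, ← Matrix.mulVec_mulVec, ← Matrix.mulVec_mulVec,
      Matrix.smul_mulVec, Matrix.one_mulVec, hx]
    simp only [Lmat_imaginary_mulVec]
    ext r
    fin_cases r <;> simp <;> ring
  · rw [CD.inner_octBasis]
    split_ifs
    · rw [mul_one, Matrix.neg_two_eq_smul]
    · simp

theorem Rmat_imaginary_mulVec (b c d e f g h x₀ x₁ x₂ x₃ x₄ x₅ x₆ x₇ : ℝ) :
    Rmat (r8 0 b c d e f g h) *ᵥ ![x₀, x₁, x₂, x₃, x₄, x₅, x₆, x₇] =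
      ![-b * x₁ - c * x₂ - d * x₃ - e * x₄ - f * x₅ - g * x₆ - h * x₇,
        b * x₀ + d * x₂ - c * x₃ + f * x₄ - e * x₅ - h * x₆ + g * x₇,
        c * x₀ - d * x₁ + b * x₃ + g * x₄ + h * x₅ - e * x₆ - f * x₇,
        d * x₀ + c * x₁ - b * x₂ + h * x₄ - g * x₅ + f * x₆ - e * x₇,
        e * x₀ - f * x₁ - g * x₂ - h * x₃ + b * x₅ + c * x₆ + d * x₇,
        f * x₀ + e * x₁ - h * x₂ + g * x₃ - b * x₄ - d * x₆ + c * x₇,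
        g * x₀ + h * x₁ + e * x₂ - f * x₃ - c * x₄ + d * x₅ - b * x₇,
        h * x₀ - g * x₁ + f * x₂ + e * x₃ - d * x₄ - c * x₅ + b * x₆] := by
  rw [Rmat_imaginary]
  ext r
  fin_cases r <;> simp [Matrix.mulVec, dotProduct, Fin.sum_univ_eight] <;> ring

theorem Rmat_clifford {α β : Fin 8} (hα : α ≠ 0) (hβ : β ≠ 0) :
    Rmat (octBasis α) * Rmat (octBasis β) + Rmat (octBasis β) * Rmat (octBasis α) =
      if α = β then -2 else 0 := by
  trans (-2 * CD.inner (octBasis α) (octBasis β)) • (1 : Matrix (Fin 8) (Fin 8) ℝ)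
  · obtain ⟨b, c, d, e, f, g, h, hu⟩ := octBasis_imaginary hα
    obtain ⟨b', c', d', e', f', g', h', hv⟩ := octBasis_imaginary hβ
    refine Matrix.mulVec_injective (funext fun x => ?_)
    have hx : x = ![x 0, x 1, x 2, x 3, x 4, x 5, x 6, x 7] := by
      ext r
      fin_cases r <;> rfl
    rw [hu, hv, CD.inner_r8, Matrix.add_mulVec, ← Matrix.mulVec_mulVec, ← Matrix.mulVec_mulVec,
      Matrix.smul_mulVec, Matrix.one_mulVec, hx]
    simp only [Rmat_imaginary_mulVec]
    ext r
    fin_cases r <;> simp <;> ring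
  · rw [CD.inner_octBasis]
    split_ifs
    · rw [mul_one, Matrix.neg_two_eq_smul]
    · simp

theorem Matrix.exists_trace_eq_natCast_of_isIdempotentElem {n K : Type*} [Fintype n]
    [DecidableEq n] [Field K] {P : Matrix n n K} (hP : IsIdempotentElem P) :
    ∃ r : ℕ, P.trace = r := by
  have h : IsIdempotentElem (Matrix.toLin' P) := by
    rw [IsIdempotentElem, Module.End.mul_eq_comp, ← Matrix.toLin'_mul, hP.eq]
  exact ⟨_, (Matrix.trace_toLin'_eq P).symm.trans
    ((LinearMap.isProj_range_iff_isIdempotentElem _).2 h).trace⟩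

/-- A family of matrices satisfying the relations of the Clifford algebra of a negative definite
form. -/
def IsCliffordFamily {ι n R : Type*} [DecidableEq ι] [Fintype n] [DecidableEq n] [CommRing R]
    (B : ι → Matrix n n R) : Prop :=
  ∀ i j, B i * B j + B j * B i = if i = j then -2 else 0

theorem IsCliffordFamily.mul_self {ι n R : Type*} [DecidableEq ι] [Fintype n] [DecidableEq n]
    [Field R] [CharZero R] {B : ι → Matrix n n R} (hB : IsCliffordFamily B) (i : ι) :
    B i * B i = -1 := by
  have h := hB i i
  rw [if_pos rfl, ← one_add_one_eq_two, neg_add, ← two_nsmul, ← two_nsmul] at h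
  have h' := congrArg (fun M => (2⁻¹ : R) • M) h
  simpa [← Nat.cast_smul_eq_nsmul R, smul_smul] using h'

theorem IsCliffordFamily.anticomm {ι n R : Type*} [DecidableEq ι] [Fintype n] [DecidableEq n]
    [CommRing R] {B : ι → Matrix n n R} (hB : IsCliffordFamily B) {i j : ι} (hij : i ≠ j) :
    B i * B j = -(B j * B i) :=
  eq_neg_of_add_eq_zero_left ((hB i j).trans (if_neg hij))

/-- `P` is the product of the spectral projections `(1 + i B₂ₗ B₂ₗ₊₁) / 2` for `l < k`. -/
theorem IsCliffordFamily.exists_idempotent {m : ℕ} {n : Type*} [Fintype n] [DecidableEq n]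
    {B : Fin (2 * m) → Matrix n n ℂ} (hB : IsCliffordFamily B) (k : ℕ) (hk : k ≤ m) :
    ∃ P : Matrix n n ℂ, IsIdempotentElem P ∧ 2 ^ k * P.trace = Fintype.card n ∧
      ∀ j, 2 * k ≤ j.val → Commute P (B j) := by
  induction k with
  | zero => exact ⟨1, IsIdempotentElem.one, by simp, fun j _ => Commute.one_left _⟩
  | succ k ih =>
    obtain ⟨P, hP, hPtr, hPB⟩ := ih (by omega)
    obtain ⟨a, ha⟩ : ∃ a : Fin (2 * m), a.val = 2 * k := ⟨⟨2 * k, by omega⟩, rfl⟩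
    obtain ⟨b, hb⟩ : ∃ b : Fin (2 * m), b.val = 2 * k + 1 := ⟨⟨2 * k + 1, by omega⟩, rfl⟩
    have hab : a ≠ b := by rintro rfl; omega
    have hPa := hPB a (by omega)
    have hPb := hPB b (by omega)
    have hsq : (B a * B b) * (B a * B b) = -1 := by
      calc (B a * B b) * (B a * B b) = B a * (B b * B a) * B b := by noncomm_ring
        _ = -((B a * B a) * (B b * B b)) := by
          rw [hB.anticomm hab.symm]; noncomm_ring
        _ = -1 := by rw [hB.mul_self, hB.mul_self]; simp
    set Q : Matrix n n ℂ := Complex.I • (B a * B b) with hQ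
    have hQQ : Q * Q = 1 := by
      rw [hQ, smul_mul_smul_comm, hsq, Complex.I_mul_I, smul_neg, neg_smul, neg_neg, one_smul]
    have hPQ : Commute P Q := (hPa.mul_right hPb).smul_right _
    have htr : (P * Q).trace = 0 := by
      have h : (P * (B a * B b)).trace = -(P * (B a * B b)).trace := by
        calc (P * (B a * B b)).trace = (B b * (P * B a)).trace := by
              rw [← mul_assoc, Matrix.trace_mul_comm]
          _ = (P * (B b * B a)).trace := by rw [← mul_assoc, ← hPb.eq, mul_assoc]
          _ = -(P * (B a * B b)).trace := by
              rw [hB.anticomm hab.symm, mul_neg, Matrix.trace_neg]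
      rw [hQ, mul_smul_comm, Matrix.trace_smul, self_eq_neg.1 h, smul_zero]
    refine ⟨(2⁻¹ : ℂ) • (P * (1 + Q)), ?_, ?_, fun j hj => ?_⟩
    · have h : (P * (1 + Q)) * (P * (1 + Q)) = (2 : ℂ) • (P * (1 + Q)) := by
        calc (P * (1 + Q)) * (P * (1 + Q)) = P * ((1 + Q) * P) * (1 + Q) := by noncomm_ring
          _ = P * P * ((1 + Q) * (1 + Q)) := by
            rw [((Commute.one_right P).add_right hPQ).symm.eq]; noncomm_ring
          _ = P * (1 + Q + (Q + Q * Q)) := by rw [hP.eq]; noncomm_ring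
          _ = (2 : ℂ) • (P * (1 + Q)) := by rw [hQQ, two_smul]; noncomm_ring
      rw [IsIdempotentElem, smul_mul_smul_comm, h, smul_smul]
      norm_num
    · rw [Matrix.trace_smul, mul_add, mul_one, Matrix.trace_add, htr, ← hPtr, smul_eq_mul]
      ring
    · have hja : j ≠ a := by rintro rfl; omega
      have hjb : j ≠ b := by rintro rfl; omega
      have hQj : Commute Q (B j) := by
        refine Commute.smul_left ?_ _
        rw [Commute, SemiconjBy, mul_assoc, ← neg_neg (B b * B j), ← hB.anticomm hjb, mul_neg,
          ← mul_assoc, ← neg_mul, ← hB.anticomm hja, mul_assoc]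
      exact ((hPB j (by omega)).mul_left ((Commute.one_left _).add_left hQj)).smul_left _

theorem IsCliffordFamily.two_pow_dvd_card {m : ℕ} {n : Type*} [Fintype n] [DecidableEq n]
    {B : Fin (2 * m) → Matrix n n ℂ} (hB : IsCliffordFamily B) : 2 ^ m ∣ Fintype.card n := by
  obtain ⟨P, hP, hPtr, -⟩ := hB.exists_idempotent m le_rfl
  obtain ⟨r, hr⟩ := Matrix.exists_trace_eq_natCast_of_isIdempotentElem hP
  refine ⟨r, ?_⟩
  rw [hr] at hPtr
  exact_mod_cast hPtr.symm

theorem IsCliffordFamily.map {ι n R S : Type*} [DecidableEq ι] [Fintype n] [DecidableEq n]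
    [CommRing R] [CommRing S] {B : ι → Matrix n n R} (hB : IsCliffordFamily B) (f : R →+* S) :
    IsCliffordFamily fun i => f.mapMatrix (B i) := by
  intro i j
  rw [← map_mul, ← map_mul, ← map_add, hB i j, apply_ite f.mapMatrix, map_neg, map_zero,
    map_ofNat]

/-- Skew-symmetric matrices satisfy the Clifford relations if and only if they define
orthonormal vector fields on the unit sphere. -/
theorem isCliffordFamily_iff_orthonormal {ι n : Type*} [DecidableEq ι] [Fintype n]
    [DecidableEq n] {B : ι → Matrix n n ℝ} (hskew : ∀ i, (B i)ᵀ = -B i) :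
    IsCliffordFamily B ↔ ∀ x : n → ℝ, x ⬝ᵥ x = 1 → ∀ i j,
      (B i).mulVec x ⬝ᵥ (B j).mulVec x = if i = j then 1 else 0 := by
  have hdot (i j : ι) (x y : n → ℝ) :
      (B i).mulVec x ⬝ᵥ (B j).mulVec y = -(x ⬝ᵥ (B i * B j).mulVec y) := by
    rw [← Matrix.mulVec_mulVec, Matrix.dotProduct_mulVec x, ← Matrix.mulVec_transpose, hskew,
      Matrix.neg_mulVec, neg_dotProduct, neg_neg]
  constructor
  · intro hB x hx i j
    have h : x ⬝ᵥ (B i * B j + B j * B i).mulVec x = -2 * if i = j then 1 else 0 := by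
      rw [hB i j]
      split_ifs
      · rw [Matrix.neg_two_eq_smul, Matrix.smul_mulVec, Matrix.one_mulVec, dotProduct_smul, hx,
          smul_eq_mul]
      · simp
    rw [Matrix.add_mulVec, dotProduct_add] at h
    have hij := hdot i j x x
    have hji := hdot j i x x
    rw [dotProduct_comm] at hji
    linarith
  · intro h i j
    have hquad (x : n → ℝ) :
        (B i).mulVec x ⬝ᵥ (B j).mulVec x = (if i = j then 1 else 0) * (x ⬝ᵥ x) := by
      rcases eq_or_ne x 0 with rfl | hx
      · simp
      have hpos : 0 < x ⬝ᵥ x := by simpa using Matrix.dotProduct_star_self_pos_iff.2 hx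
      have hs := Real.mul_self_sqrt hpos.le
      have hne := (Real.sqrt_pos.2 hpos).ne'
      have := h ((√(x ⬝ᵥ x))⁻¹ • x) (by
        rw [smul_dotProduct, dotProduct_smul, smul_eq_mul, smul_eq_mul]
        field_simp
        rw [sq, hs]) i j
      rw [Matrix.mulVec_smul, Matrix.mulVec_smul, smul_dotProduct, dotProduct_smul, smul_eq_mul,
        smul_eq_mul] at this
      rw [← this]
      field_simp
      rw [sq, hs]
    have hpolar (x y : n → ℝ) : x ⬝ᵥ (B i * B j + B j * B i).mulVec y =
        -2 * (if i = j then 1 else 0) * (x ⬝ᵥ y) := by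
      have hxy := hquad (x + y)
      have hji := hdot j i x y
      simp only [Matrix.mulVec_add, add_dotProduct, dotProduct_add, hquad x, hquad y,
        hdot i j x y, dotProduct_comm y x] at hxy
      rw [dotProduct_comm] at hji
      rw [Matrix.add_mulVec, dotProduct_add]
      linarith
    ext r s
    have := hpolar (Pi.single r 1) (Pi.single s 1)
    simp only [Matrix.mulVec_single_one, single_one_dotProduct] at this
    change (B i * B j + B j * B i) r s = _ at this
    rw [this]
    split_ifs
    · rw [Matrix.neg_two_eq_smul, Matrix.smul_apply, Matrix.one_apply, Pi.single_apply]
      simp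
    · simp

open scoped Kronecker

theorem Cmat_eq_toMat16 : Cmat 16 = toMat16 (Matrix.fromBlocks 1 0 0 (-1)) := by
  have h : Cmat 16 = toMat16 (Matrix.diagonal
      (Sum.elim (fun _ => 1) (fun _ => -1) : Fin 8 ⊕ Fin 8 → ℝ)) := by
    rw [toMat16, Matrix.reindex_apply, Matrix.submatrix_diagonal_equiv, Cmat]
    congr 1
    ext i
    obtain ⟨i | i, rfl⟩ :=
      (finSumFinEquiv.trans (finCongr (show 8 + 8 = 16 by norm_num))).surjective i
    · have hi : 2 * ((finSumFinEquiv (Sum.inl i : Fin 8 ⊕ Fin 8)).cast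
          (show 8 + 8 = 16 by norm_num)).val < 16 := by
        have := i.isLt
        simp only [finSumFinEquiv_apply_left, Fin.val_cast, Fin.val_castAdd]
        omega
      simpa using fun h => absurd hi (not_lt.2 h)
    · have hi : ¬2 * ((finSumFinEquiv (Sum.inr i : Fin 8 ⊕ Fin 8)).cast
          (show 8 + 8 = 16 by norm_num)).val < 16 := by
        simp only [finSumFinEquiv_apply_right, Fin.val_cast, Fin.val_natAdd]
        omega
      simpa using fun h => absurd h hi
  rw [h, ← Matrix.fromBlocks_diagonal, ← Matrix.diagonal_one, ← Matrix.diagonal_neg]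

theorem toMat16_add (M N : Matrix (Fin 8 ⊕ Fin 8) (Fin 8 ⊕ Fin 8) ℝ) :
    toMat16 (M + N) = toMat16 M + toMat16 N := rfl

theorem toMat16_neg (M : Matrix (Fin 8 ⊕ Fin 8) (Fin 8 ⊕ Fin 8) ℝ) :
    toMat16 (-M) = -toMat16 M := rfl

theorem toMat16_mul (M N : Matrix (Fin 8 ⊕ Fin 8) (Fin 8 ⊕ Fin 8) ℝ) :
    toMat16 (M * N) = toMat16 M * toMat16 N :=
  map_mul (Matrix.reindexAlgEquiv ℝ ℝ _) M N

theorem toMat16_transpose (M : Matrix (Fin 8 ⊕ Fin 8) (Fin 8 ⊕ Fin 8) ℝ) :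
    (toMat16 M)ᵀ = toMat16 Mᵀ := rfl

theorem toMat16_one : toMat16 1 = 1 :=
  map_one (Matrix.reindexAlgEquiv ℝ ℝ _)

theorem Cmat_transpose (N : ℕ) : (Cmat N)ᵀ = Cmat N :=
  Matrix.diagonal_transpose _

theorem Cmat_mul_self (N : ℕ) : Cmat N * Cmat N = 1 := by
  rw [Cmat, Matrix.diagonal_mul_diagonal, ← Matrix.diagonal_one]
  congr 1
  ext i
  split_ifs <;> norm_num

theorem J16_transpose (α : Fin 8) : (J16 α)ᵀ = -J16 α := by
  rw [J16, toMat16_transpose, ← toMat16_neg]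
  split_ifs with hα
  · simp [Matrix.fromBlocks_transpose, Matrix.fromBlocks_neg]
  · simp [Matrix.fromBlocks_transpose, Matrix.fromBlocks_neg, Rmat_transpose hα]

theorem Cmat_mul_J16 (α : Fin 8) : Cmat 16 * J16 α = -(J16 α * Cmat 16) := by
  rw [Cmat_eq_toMat16, J16, ← toMat16_mul, ← toMat16_mul, ← toMat16_neg]
  split_ifs <;> simp [Matrix.fromBlocks_multiply, Matrix.fromBlocks_neg]

theorem isCliffordFamily_J16 : IsCliffordFamily J16 := by
  intro α β
  have hrhs : (if α = β then -2 else 0 : Matrix (Fin 16) (Fin 16) ℝ) =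
      toMat16 (Matrix.fromBlocks (if α = β then -2 else 0) 0 0 (if α = β then -2 else 0)) := by
    split_ifs
    · rw [← one_add_one_eq_two, ← toMat16_one, ← toMat16_add, ← toMat16_neg,
        ← Matrix.fromBlocks_one, Matrix.fromBlocks_add, Matrix.fromBlocks_neg]
      simp [one_add_one_eq_two]
    · rw [Matrix.fromBlocks_zero]
      rfl
  rw [hrhs, J16, J16, ← toMat16_mul, ← toMat16_mul, ← toMat16_add]
  congr 1
  by_cases hα : α = 0 <;> by_cases hβ : β = 0
  · subst hα hβ
    simp [Matrix.fromBlocks_multiply, Matrix.fromBlocks_add, ← one_add_one_eq_two]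
  · subst hα
    simp [Matrix.fromBlocks_multiply, Matrix.fromBlocks_add, hβ, Ne.symm hβ]
  · subst hβ
    simp [Matrix.fromBlocks_multiply, Matrix.fromBlocks_add, hα]
  · simp [Matrix.fromBlocks_multiply, Matrix.fromBlocks_add, hα, hβ, Rmat_clifford hα hβ]

/-- The identification `ℝ^8 ⊗ ℝ^16 = ℝ^128` on the level of matrices. -/
noncomputable def tensorAlgEquiv :
    Matrix (Fin 8 × Fin 16) (Fin 8 × Fin 16) ℝ ≃ₐ[ℝ] Matrix (Fin 128) (Fin 128) ℝ :=
  Matrix.reindexAlgEquiv ℝ ℝ (finProdFinEquiv.trans (finCongr (by norm_num)))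

theorem castM_diagExt (A : Matrix (Fin 16) (Fin 16) ℝ) :
    castM (by norm_num) (diagExt 16 8 A) = tensorAlgEquiv (1 ⊗ₖ A) := by
  ext i j
  simp [castM, diagExt, tensorAlgEquiv, Matrix.one_apply, Fin.ext_iff]
  rfl

theorem castM_blockExt (B : Matrix (Fin 8) (Fin 8) ℝ) :
    castM (by norm_num) (blockExt 8 16 B) = tensorAlgEquiv (B ⊗ₖ 1) := by
  ext i j
  simp [castM, blockExt, tensorAlgEquiv, Matrix.one_apply, Fin.ext_iff]
  rfl

theorem tensorAlgEquiv_transpose (M : Matrix (Fin 8 × Fin 16) (Fin 8 × Fin 16) ℝ) :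
    (tensorAlgEquiv M)ᵀ = tensorAlgEquiv Mᵀ := rfl

theorem A128_eq_tensor (α : Fin 8) : A128 α = tensorAlgEquiv (1 ⊗ₖ J16 α) :=
  castM_diagExt _

theorem L128_eq_tensor (α : Fin 8) :
    L128 α = tensorAlgEquiv (Lmat (octBasis α) ⊗ₖ Cmat 16) := by
  rw [L128, castM_diagExt, castM_blockExt, ← map_mul, ← Matrix.mul_kronecker_mul, one_mul,
    mul_one]

theorem A128_transpose (α : Fin 8) : (A128 α)ᵀ = -A128 α := by
  rw [A128_eq_tensor, tensorAlgEquiv_transpose, ← Matrix.kroneckerMap_transpose, J16_transpose,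
    Matrix.transpose_one, ← map_neg]
  congr 1
  ext i j
  simp

theorem L128_transpose {α : Fin 8} (hα : α ≠ 0) : (L128 α)ᵀ = -L128 α := by
  rw [L128_eq_tensor, tensorAlgEquiv_transpose, ← Matrix.kroneckerMap_transpose,
    Lmat_transpose hα, Cmat_transpose, ← map_neg]
  congr 1
  ext i j
  simp

theorem isCliffordFamily_A128 : IsCliffordFamily A128 := by
  intro α β
  rw [A128_eq_tensor, A128_eq_tensor, ← map_mul, ← map_mul, ← Matrix.mul_kronecker_mul,
    ← Matrix.mul_kronecker_mul, ← map_add, one_mul, ← Matrix.kronecker_add,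
    isCliffordFamily_J16 α β]
  split_ifs
  · rw [Matrix.neg_two_eq_smul, Matrix.kronecker_smul, Matrix.one_kronecker_one, map_smul,
      map_one, Matrix.neg_two_eq_smul]
  · simp

theorem L128_clifford {α β : Fin 8} (hα : α ≠ 0) (hβ : β ≠ 0) :
    L128 α * L128 β + L128 β * L128 α = if α = β then -2 else 0 := by
  rw [L128_eq_tensor, L128_eq_tensor, ← map_mul, ← map_mul, ← Matrix.mul_kronecker_mul,
    ← Matrix.mul_kronecker_mul, ← map_add, Cmat_mul_self, ← Matrix.add_kronecker,
    Lmat_clifford hα hβ]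
  split_ifs
  · rw [Matrix.neg_two_eq_smul, Matrix.smul_kronecker, Matrix.one_kronecker_one, map_smul,
      map_one, Matrix.neg_two_eq_smul]
  · simp

theorem A128_mul_L128 (α β : Fin 8) : A128 α * L128 β + L128 β * A128 α = 0 := by
  rw [A128_eq_tensor, L128_eq_tensor, ← map_mul, ← map_mul, ← Matrix.mul_kronecker_mul,
    ← Matrix.mul_kronecker_mul, ← map_add, Cmat_mul_J16, one_mul, mul_one,
    ← Matrix.kronecker_add, add_neg_cancel, Matrix.kronecker_zero, map_zero]

theorem G128_transpose (β : Fin 15) : (G128 β)ᵀ = -G128 β := by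
  rw [G128]
  split_ifs with h
  · exact A128_transpose _
  · exact L128_transpose (by simp [Fin.ext_iff]; omega)

theorem isCliffordFamily_G128 : IsCliffordFamily G128 := by
  intro β γ
  have hne {i : Fin 15} (hi : ¬i.val < 8) : (⟨i.val - 7, by omega⟩ : Fin 8) ≠ 0 := by
    rw [Ne, Fin.ext_iff]
    simp only [Fin.val_zero]
    omega
  by_cases hβ : β.val < 8 <;> by_cases hγ : γ.val < 8
  · rw [G128, G128, dif_pos hβ, dif_pos hγ, isCliffordFamily_A128]
    simp [Fin.ext_iff]
  · rw [G128, G128, dif_pos hβ, dif_neg hγ, A128_mul_L128, if_neg]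
    rintro rfl
    exact hγ hβ
  · rw [G128, G128, dif_neg hβ, dif_pos hγ, add_comm, A128_mul_L128, if_neg]
    rintro rfl
    exact hβ hγ
  · rw [G128, G128, dif_neg hβ, dif_neg hγ, L128_clifford (hne hβ) (hne hγ)]
    refine if_congr ?_ rfl rfl
    simp only [Fin.ext_iff]
    omega

/-- The fifteen matrices `diag_{16,8}(J_α)` (`α = 1,…,8`) and
`diag_{16,8}(C₁) · block_{8,16}(L_u)` (`u ∈ {i,j,k,e,f,g,h}`) on `ℝ^128` are
skew-symmetric, square to `-Id₁₂₈` and pairwise anticommute, hence give `15`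
orthonormal tangent vector fields on `S^127`; and `15` is the maximal possible
number, i.e. there is no such family of `16` linear vector fields. -/
theorem fifteen_fields_on_S127 :
    (∀ β γ : Fin 15, (G128 β)ᵀ = -G128 β ∧ G128 β * G128 β = -1 ∧
      (β ≠ γ → G128 β * G128 γ + G128 γ * G128 β = 0)) ∧
    (∀ x : Fin 128 → ℝ, x ⬝ᵥ x = 1 → ∀ β γ : Fin 15,
      (G128 β).mulVec x ⬝ᵥ x = 0 ∧
      (G128 β).mulVec x ⬝ᵥ (G128 γ).mulVec x = if β = γ then 1 else 0) ∧
    ¬∃ B : Fin 16 → Matrix (Fin 128) (Fin 128) ℝ,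
      (∀ i, (B i)ᵀ = -B i) ∧
      ∀ x : Fin 128 → ℝ, x ⬝ᵥ x = 1 → ∀ i j,
        (B i).mulVec x ⬝ᵥ (B j).mulVec x = if i = j then 1 else 0 := by
  have hcliff := isCliffordFamily_G128
  refine ⟨fun β γ => ⟨G128_transpose β, hcliff.mul_self β, fun h => ?_⟩,
    fun x hx β γ => ⟨?_, (isCliffordFamily_iff_orthonormal G128_transpose).1 hcliff x hx β γ⟩,
    ?_⟩
  · rw [hcliff β γ, if_neg h]
  · have h : (G128 β).mulVec x ⬝ᵥ x = -((G128 β).mulVec x ⬝ᵥ x) := by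
      conv_lhs => rw [dotProduct_comm, Matrix.dotProduct_mulVec, ← Matrix.mulVec_transpose,
        G128_transpose, Matrix.neg_mulVec, neg_dotProduct]
    exact self_eq_neg.1 h
  · rintro ⟨B, hskew, hB⟩
    have h := (isCliffordFamily_iff_orthonormal hskew).2 hB
    have hdvd := IsCliffordFamily.two_pow_dvd_card (m := 8) (h.map Complex.ofRealHom)
    norm_num at hdvd
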